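/- Fix integers n ≥ 2 and 1 ≤ k ≤ n−1. For every nonnegative integer j with k(n−k)−j even and 0 ≤ j ≤ k(n−k), the multiplicity of F_j in ∧^k ℂ^n regarded as a representation of the principal sl_2-subalgebra of sl_n(ℂ) (i.e., dim V_j − dim V_{j+2} for the eigenspaces of H_n on ∧^k ℂ^n) equals π(n−k, k, (k(n−k)−j)/2) − π(n−k, k, (k(n−k)−j)/2 − 1). -/

import Mathlib

/-- Index set for the standard basis of `⋀^k ℂ^n`: a subset `S` of size `k`
encodes the wedge `e_{i_1} ∧ ⋯ ∧ e_{i_k}` over the elements of `S` in increasing order. -/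
abbrev WedgeIdx (n k : ℕ) := {S : Finset (Fin n) // S.card = k}

/-- Model of the exterior power `⋀^k ℂ^n`, presented via its standard basis of
wedges of standard basis vectors. -/
abbrev Wedge (n k : ℕ) := WedgeIdx n k →₀ ℂ

/-- The action on `⋀^k ℂ^n` (as a derivation) of the diagonal matrix with diagonal
entries `h`: the basis wedge indexed by `S` is an eigenvector of eigenvalue `∑ i ∈ S, h i`. -/
noncomputable def wedgeH (n k : ℕ) (h : Fin n → ℤ) : Module.End ℂ (Wedge n k) :=
  (Finsupp.basisSingleOne (R := ℂ)).constr ℂ fun S =>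
    ((∑ i ∈ S.1, h i : ℤ) : ℂ) • Finsupp.single S 1

/-- `dim V_j`: the dimension of the eigenvalue-`j` eigenspace of the diagonal action. -/
noncomputable def eigdim (n k : ℕ) (h : Fin n → ℤ) (j : ℤ) : ℕ :=
  Module.finrank ℂ ↥(Module.End.eigenspace (wedgeH n k h) (j : ℂ))

/-- The multiplicity of the irreducible `sl₂`-representation `F_j` in `⋀^k ℂ^n`:
`dim V_j - dim V_{j+2}`. -/
noncomputable def multF (n k : ℕ) (h : Fin n → ℤ) (j : ℤ) : ℤ :=
  (eigdim n k h j : ℤ) - eigdim n k h (j + 2)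

/-- The diagonal of `H_n = diag (n-1, n-3, …, -(n-1))`, the semisimple element of the
principal `sl₂`-triple of `sl_n(ℂ)` (0-indexed: entry `i` is `n - 1 - 2i`). -/
def hPrin (n : ℕ) : Fin n → ℤ := fun i => (n : ℤ) - 1 - 2 * (i : ℕ)

/-- `π(n, k, d)`: the number of partitions of `d` into at most `k` parts, each part of size
at most `n` (realized as weakly decreasing `k`-tuples with entries in `{0,…,n}` summing
to `d`); it is `0` for `d < 0`. -/
def piPart (n k : ℕ) (d : ℤ) : ℕ :=
  (Finset.univ.filter fun f : Fin k → Fin (n + 1) =>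
    (∀ i j : Fin k, i ≤ j → (f j : ℕ) ≤ (f i : ℕ)) ∧ (∑ i, ((f i : ℕ) : ℤ)) = d).card

lemma wedgeH_apply (n k : ℕ) (h : Fin n → ℤ) (v : Wedge n k) (S : WedgeIdx n k) :
    wedgeH n k h v S = ((∑ i ∈ S.1, h i : ℤ) : ℂ) * v S := by
  induction v using Finsupp.induction_linear with
  | zero => simp
  | add f g hf hg => simp only [map_add, Finsupp.add_apply, hf, hg, mul_add]
  | single T c =>
    have hsingle : wedgeH n k h (Finsupp.single T 1) =
        ((∑ i ∈ T.1, h i : ℤ) : ℂ) • Finsupp.single T 1 := by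
      have hT := (Finsupp.basisSingleOne (R := ℂ)).constr_basis ℂ
        (fun S : WedgeIdx n k => ((∑ i ∈ S.1, h i : ℤ) : ℂ) • Finsupp.single S (1 : ℂ)) T
      rwa [Finsupp.coe_basisSingleOne] at hT
    rw [← mul_one c, ← smul_eq_mul, ← Finsupp.smul_single, map_smul, hsingle]
    by_cases hT : T = S
    · subst hT; simp [mul_comm]
    · simp [Finsupp.single_eq_of_ne' hT]

lemma eigdim_eq_card (n k : ℕ) (h : Fin n → ℤ) (j : ℤ) :
    eigdim n k h j = (Finset.univ.filter fun S : WedgeIdx n k => ∑ i ∈ S.1, h i = j).card := by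
  classical
  have key : Module.End.eigenspace (wedgeH n k h) (j : ℂ) =
      Finsupp.supported ℂ ℂ {S : WedgeIdx n k | ∑ i ∈ S.1, h i = j} := by
    ext v
    rw [Module.End.mem_eigenspace_iff, Finsupp.mem_supported']
    constructor
    · intro hv S hS
      have h1 := DFunLike.congr_fun hv S
      rw [wedgeH_apply, Finsupp.smul_apply, smul_eq_mul] at h1
      by_contra h0
      exact hS (by exact_mod_cast mul_right_cancel₀ h0 h1)
    · intro hv
      ext S
      rw [wedgeH_apply, Finsupp.smul_apply, smul_eq_mul]
      by_cases hS : ∑ i ∈ S.1, h i = j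
      · rw [hS]
      · simp [hv S hS]
  rw [eigdim, key, (Finsupp.supportedEquivFinsupp _).finrank_eq, Module.finrank_finsupp_self,
    Fintype.card_subtype]
  rfl

lemma StrictMono.fin_add_le {n k : ℕ} {g : Fin k → Fin n} (hg : StrictMono g) {i j : Fin k}
    (hij : i ≤ j) : (g i : ℕ) + j ≤ g j + i := by
  obtain ⟨j, hj⟩ := j
  induction j with
  | zero =>
    obtain rfl : i = ⟨0, hj⟩ := le_antisymm hij (Fin.mk_le_mk.2 (Nat.zero_le _))
    exact le_rfl
  | succ m ih =>
    rcases hij.eq_or_lt with rfl | hlt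
    · exact le_rfl
    · have h1 := ih (by omega) (Fin.le_def.2 (Nat.le_of_lt_succ (Fin.lt_def.1 hlt)))
      have h2 : g ⟨m, by omega⟩ < g ⟨m + 1, hj⟩ := hg (Fin.mk_lt_mk.2 m.lt_succ_self)
      have h3 := Fin.lt_def.1 h2
      simp only at h1 ⊢
      omega

/-- The strictly increasing tuple obtained from a tuple `f` (a partition, if `f` is weakly
decreasing) by reversing it and adding the staircase `(0, 1, …, k - 1)`. -/
def addStaircase {n k : ℕ} (hk : k ≤ n) (f : Fin k → Fin (n - k + 1)) (i : Fin k) : Fin n :=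
  ⟨f i.rev + i, by have := (f i.rev).2; have := i.2; omega⟩

lemma addStaircase_strictMono {n k : ℕ} (hk : k ≤ n) {f : Fin k → Fin (n - k + 1)}
    (hf : ∀ i j : Fin k, i ≤ j → (f j : ℕ) ≤ (f i : ℕ)) : StrictMono (addStaircase hk f) := by
  intro i j hij
  have h1 := hf j.rev i.rev (Fin.rev_le_rev.2 hij.le)
  have h2 := Fin.lt_def.1 hij
  simp only [addStaircase, Fin.mk_lt_mk]
  omega

lemma addStaircase_injective {n k : ℕ} (hk : k ≤ n) :
    Function.Injective (addStaircase (n := n) (k := k) hk) := by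
  intro f f' h
  funext i
  have h1 := congrArg Fin.val (congrFun h i.rev)
  simp only [addStaircase, Fin.rev_rev] at h1
  exact Fin.ext (by omega)

lemma StrictMono.exists_addStaircase {n k : ℕ} (hk : k ≤ n) {g : Fin k → Fin n}
    (hg : StrictMono g) : ∃ f : Fin k → Fin (n - k + 1),
      (∀ i j : Fin k, i ≤ j → (f j : ℕ) ≤ (f i : ℕ)) ∧ addStaircase hk f = g := by
  have lower (i : Fin k) : (i : ℕ) ≤ g i := by
    have := hg.fin_add_le (i := ⟨0, i.pos⟩) (j := i) (Fin.mk_le_mk.2 (Nat.zero_le _))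
    simp only at this
    omega
  have upper (i : Fin k) : (g i : ℕ) - i < n - k + 1 := by
    have h1 := i.2
    have h2 := hg.fin_add_le (i := i) (j := ⟨k - 1, by omega⟩)
      (Fin.le_def.2 (Nat.le_sub_one_of_lt h1))
    have h3 := (g ⟨k - 1, by omega⟩).2
    simp only at h2
    omega
  refine ⟨fun i => ⟨g i.rev - i.rev, upper _⟩, fun i j hij => ?_, ?_⟩
  · have := hg.fin_add_le (Fin.rev_le_rev.2 hij)
    simp only
    omega
  · funext i
    have := lower i
    apply Fin.ext
    simp only [addStaircase, Fin.rev_rev]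
    omega

lemma sum_hPrin_addStaircase {n k : ℕ} (hk : k ≤ n) (f : Fin k → Fin (n - k + 1)) :
    ∑ i, hPrin n (addStaircase hk f i) =
      (k : ℤ) * ((n : ℤ) - k) - 2 * ∑ i, ((f i : ℕ) : ℤ) := by
  have h1 : ∑ i : Fin k, ((f i.rev : ℕ) : ℤ) = ∑ i, ((f i : ℕ) : ℤ) :=
    Equiv.sum_comp Fin.revPerm fun i => ((f i : ℕ) : ℤ)
  have h2 : (∑ i : Fin k, ((i : ℕ) : ℤ)) * 2 = k * (k - 1) := by
    rw [Fin.sum_univ_eq_sum_range (fun i => (i : ℤ)) k]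
    clear h1 f hk
    induction k with
    | zero => simp
    | succ m ih => rw [Finset.sum_range_succ, add_mul, ih]; push_cast; ring
  simp only [hPrin, addStaircase, Nat.cast_add, mul_add, Finset.sum_sub_distrib,
    Finset.sum_add_distrib, ← Finset.mul_sum, h1, Finset.sum_const, Finset.card_univ,
    Fintype.card_fin, nsmul_eq_mul]
  linear_combination -h2

lemma eigdim_hPrin {n k : ℕ} (hk : k ≤ n) {j d : ℤ} (hd : (k : ℤ) * ((n : ℤ) - k) - j = 2 * d) :
    eigdim n k (hPrin n) j = piPart (n - k) k d := by
  classical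
  rw [eigdim_eq_card, piPart]
  symm
  refine Finset.card_bij
    (fun f hf => ⟨Finset.univ.map ⟨addStaircase hk f,
      (addStaircase_strictMono hk (Finset.mem_filter.1 hf).2.1).injective⟩, by simp⟩) ?_ ?_ ?_
  · intro f hf
    have h := (Finset.mem_filter.1 hf).2.2
    rw [Finset.mem_filter]
    refine ⟨Finset.mem_univ _, ?_⟩
    simp only [Finset.sum_map, Function.Embedding.coeFn_mk, sum_hPrin_addStaircase]
    omega
  · intro f hf f' hf' h
    apply addStaircase_injective hk
    rw [← StrictMono.range_inj (addStaircase_strictMono hk (Finset.mem_filter.1 hf).2.1)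
      (addStaircase_strictMono hk (Finset.mem_filter.1 hf').2.1)]
    simpa using congrArg (fun S : WedgeIdx n k => (S.1 : Set (Fin n))) h
  · rintro ⟨S, hS⟩ hj
    have hsum := (Finset.mem_filter.1 hj).2
    obtain ⟨f, hf, hfg⟩ := (S.orderEmbOfFin hS).strictMono.exists_addStaircase hk
    have himg : Finset.univ.map ⟨addStaircase hk f,
        (addStaircase_strictMono hk hf).injective⟩ = S := by
      apply Finset.coe_injective
      simp [hfg]
    refine ⟨f, ?_, Subtype.ext himg⟩
    rw [Finset.mem_filter]
    refine ⟨Finset.mem_univ _, hf, ?_⟩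
    simp only at hsum
    rw [← himg, Finset.sum_map] at hsum
    simp only [Function.Embedding.coeFn_mk, sum_hPrin_addStaircase] at hsum
    omega

/-- for `0 ≤ j ≤ k(n-k)` with `k(n-k) - j` even, the multiplicity of `F_j`
in `⋀^k ℂ^n` under the principal `sl₂`-subalgebra of `sl_n(ℂ)` equals
`π(n-k, k, (k(n-k)-j)/2) - π(n-k, k, (k(n-k)-j)/2 - 1)`. -/
theorem stmt7 (n k : ℕ) (hn : 2 ≤ n) (hk1 : 1 ≤ k) (hkn : k ≤ n - 1) (j : ℕ)
    (hpar : (2 : ℤ) ∣ ((k : ℤ) * ((n : ℤ) - k) - j))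
    (hj : (j : ℤ) ≤ (k : ℤ) * ((n : ℤ) - k)) :
    multF n k (hPrin n) j =
      piPart (n - k) k (((k : ℤ) * ((n : ℤ) - k) - j) / 2) -
        piPart (n - k) k (((k : ℤ) * ((n : ℤ) - k) - j) / 2 - 1) := by
  obtain ⟨d, hd⟩ := hpar
  have hk : k ≤ n := by omega
  rw [hd, Int.mul_ediv_cancel_left d two_ne_zero, multF, eigdim_hPrin hk hd,
    eigdim_hPrin hk (d := d - 1) (by linarith)]
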